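/- arXiv:1311.3171 — 4 statements merged into one kernel-verified Lean document; each statement's English description precedes it below -/
import Mathlib

section
/- For every n ≥ 1 and every permutation π of the set Fin n → Bool, the De Bruijn layered graph with 4n+1 columns admits a system of node-disjoint paths realizing π. Precisely, there exists a function P : (Fin n → Bool) → Fin (4n+1) → (Fin n → Bool) such that: (i) P w 0 = w for every w; (ii) P w (4n) = π w for every w; (iii) for every w and every i < 4n, either P w (i+1) = sr (P w i) or P w (i+1) = (fun j => xor (sr (P w i) j) (e j)); and (iv) for every column index i, the map w ↦ P w i is injective. -/
/-- Cyclic right shift on bit-vectors: `(sr w) j = w (j - 1)`, indices mod `n`. -/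
def sr {n : ℕ} (w : Fin n → Bool) : Fin n → Bool :=
  fun j => w ⟨(j.val + (n - 1)) % n, Nat.mod_lt _ j.pos⟩

/-- The indicator vector of position 0: `e 0 = true`, `e j = false` otherwise. -/
def ebit {n : ℕ} : Fin n → Bool :=
  fun j => decide (j.val = 0)

open scoped Pointwise

namespace DeBruijn

section Coloring

variable {X : Type*}

/-- Two fixed-point-free involutions admit a common two-colouring: the union of two perfect
matchings is bipartite. -/
theorem exists_coloring_of_involutions (s t : Equiv.Perm X) (hs : s * s = 1) (ht : t * t = 1)
    (hs' : ∀ x, s x ≠ x) (ht' : ∀ x, t x ≠ x) :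
    ∃ c : X → Bool, (∀ x, c (s x) = !c x) ∧ ∀ x, c (t x) = !c x := by
  classical
  have hsi : s⁻¹ = s := inv_eq_of_mul_eq_one_left hs
  have hti : t⁻¹ = t := inv_eq_of_mul_eq_one_left ht
  set r : Equiv.Perm X := s * t with hr
  have hsr : ∀ k : ℤ, s * r ^ k = r ^ (-k) * s := by
    have h : SemiconjBy s r r⁻¹ := by
      simp only [SemiconjBy, hr, mul_inv_rev, hsi, hti, mul_assoc, hs]
      simp [← mul_assoc, hs]
    intro k
    simpa using (h.zpow_right k).eq
  have htr : t = s * r := by rw [hr, ← mul_assoc, hs, one_mul]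
  have hnot : ∀ x, ¬ r.SameCycle x (s x) := by
    rintro x ⟨k, hk⟩
    obtain ⟨m, rfl | rfl⟩ := Int.even_or_odd' k
    · apply hs' ((r ^ m) x)
      rw [← Equiv.Perm.mul_apply, hsr, Equiv.Perm.mul_apply, ← hk, ← Equiv.Perm.mul_apply,
        ← zpow_add]
      congr 2
      ring
    · apply ht' ((r ^ m) x)
      rw [← Equiv.Perm.mul_apply, htr, mul_assoc, ← zpow_one_add, hsr, Equiv.Perm.mul_apply, ← hk,
        ← Equiv.Perm.mul_apply, ← zpow_add]
      congr 2
      ring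
  have hmap : ∀ x y, r.SameCycle x y → r.SameCycle (s x) (s y) := by
    rintro x y ⟨k, rfl⟩
    refine ⟨-k, ?_⟩
    rw [← Equiv.Perm.mul_apply, ← hsr, Equiv.Perm.mul_apply]
  let Q := Quotient (Equiv.Perm.SameCycle.setoid r)
  let q : X → Q := fun x => Quotient.mk _ x
  let : LinearOrder Q := linearOrderOfSTO WellOrderingRel
  have hqt : ∀ x, q (t x) = q (s x) := fun x => Quotient.sound <| by
    have h := hmap (r x) x (Equiv.Perm.SameCycle.symm ⟨1, by simp⟩)
    rwa [← Equiv.Perm.mul_apply, ← htr] at h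
  have hss : ∀ x, s (s x) = x := fun x => by rw [← Equiv.Perm.mul_apply, hs]; rfl
  have hne : ∀ x, q x ≠ q (s x) := fun x h => hnot x (Quotient.exact h)
  have hst : ∀ x, q (s (t x)) = q x := fun x =>
    Quotient.sound (Equiv.Perm.SameCycle.symm ⟨1, by simp [hr]⟩)
  refine ⟨fun x => decide (q x < q (s x)), fun x => ?_, fun x => ?_⟩
  · rcases lt_or_gt_of_ne (hne x) with h | h <;> simp [hss, h, h.le]
  · rcases lt_or_gt_of_ne (hne x) with h | h <;> simp [hqt, hst, h, h.le]

end Coloring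

section Switches

variable {ι : Type*}

/-- The permutations of bit-vectors that change at most the coordinate `j`. -/
def switches (j : ι) : Set (Equiv.Perm (ι → Bool)) :=
  {g | ∀ x i, i ≠ j → g x i = x i}

theorem one_mem_switches (j : ι) : 1 ∈ switches j := fun _ _ _ => rfl

theorem inv_mem_switches {j : ι} {g : Equiv.Perm (ι → Bool)} (hg : g ∈ switches j) :
    g⁻¹ ∈ switches j := fun x i hi => by
  simpa using (hg (g⁻¹ x) i hi).symm

/-- Permutation of the coordinates of bit-vectors. -/
def permuteCoords : Equiv.Perm ι →* Equiv.Perm (ι → Bool) where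
  toFun σ := Equiv.arrowCongr σ (Equiv.refl Bool)
  map_one' := rfl
  map_mul' _ _ := rfl

theorem permuteCoords_apply (σ : Equiv.Perm ι) (x : ι → Bool) (i : ι) :
    permuteCoords σ x i = x (σ⁻¹ i) := rfl

theorem permuteCoords_inv_apply (σ : Equiv.Perm ι) (x : ι → Bool) (i : ι) :
    (permuteCoords σ)⁻¹ x i = x (σ i) := rfl

theorem switches_permuteCoords (σ : Equiv.Perm ι) (j : ι) :
    switches (σ j) = MulAut.conj (permuteCoords σ) '' switches j := by
  ext g
  constructor
  · intro hg
    refine ⟨(permuteCoords σ)⁻¹ * g * permuteCoords σ, fun x i hi => ?_, by simp [mul_assoc]⟩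
    have := hg (permuteCoords σ x) (σ i) (by simpa using hi)
    rw [permuteCoords_apply, show σ⁻¹ (σ i) = i from σ.symm_apply_apply i] at this
    exact this
  · rintro ⟨s, hs, rfl⟩ x i hi
    have := hs ((permuteCoords σ)⁻¹ x) (σ⁻¹ i) (fun h => hi (by simp [← h]))
    simpa [permuteCoords_apply, permuteCoords_inv_apply] using this

theorem permuteCoords_mul_switches (σ : Equiv.Perm ι) (j : ι) :
    {permuteCoords σ} * switches j = switches (σ j) * {permuteCoords σ} := by
  rw [switches_permuteCoords, Set.singleton_mul, Set.mul_singleton, Set.image_image]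
  simp

/-- The permutations obtained from one switch per coordinate of `l`, the head of `l` being
applied last. -/
def passes (l : List ι) : Set (Equiv.Perm (ι → Bool)) := (l.map switches).prod

theorem passes_cons (j : ι) (l : List ι) : passes (j :: l) = switches j * passes l := by
  simp [passes]

theorem passes_append (l l' : List ι) : passes (l ++ l') = passes l * passes l' := by
  simp [passes]

theorem passes_map_permuteCoords (σ : Equiv.Perm ι) (l : List ι) :
    passes (l.map σ) = MulAut.conj (permuteCoords σ) '' passes l := by
  rw [passes, passes, Set.image_list_prod, List.map_map, List.map_map]
  simp [Function.comp_def, switches_permuteCoords]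

theorem list_prod_mem_passes (l : List ι) (g : ι → Equiv.Perm (ι → Bool))
    (hg : ∀ i, g i ∈ switches i) : (l.map g).prod ∈ passes l :=
  match l with
  | [] => by simp [passes]
  | j :: l => by
    rw [passes_cons, List.map_cons, List.prod_cons]
    exact Set.mul_mem_mul (hg j) (list_prod_mem_passes l g hg)

variable [DecidableEq ι]

/-- The involution flipping coordinate `j`. -/
def flip (j : ι) : Equiv.Perm (ι → Bool) :=
  Function.Involutive.toPerm (fun x => Function.update x j (!x j)) fun x => by simp

theorem flip_apply (j : ι) (x : ι → Bool) : flip j x = Function.update x j (!x j) := rfl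

theorem flip_mul_flip (j : ι) : flip j * flip j = 1 := by
  ext x; simp [flip_apply]

theorem flip_ne (j : ι) (x : ι → Bool) : flip j x ≠ x := fun h => by
  simpa [flip_apply] using congrFun h j

/-- A colouring separating the pairs `{x, flip j x}` is the coordinate `j` after a suitable
switch. -/
theorem exists_switch_of_coloring [Finite ι] (j : ι) (c : (ι → Bool) → Bool)
    (hc : ∀ x, c (flip j x) = !c x) : ∃ g ∈ switches j, ∀ x, g x j = c x := by
  have hinj : Function.Injective fun x => Function.update x j (c x) := by
    intro x y h
    have hj : c x = c y := by simpa using congrFun h j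
    have hi : ∀ i, i ≠ j → x i = y i := fun i hi => by simpa [hi] using congrFun h i
    by_cases hxy : x j = y j
    · funext i
      by_cases hij : i = j
      · rw [hij, hxy]
      · exact hi i hij
    · have : y = flip j x := by
        funext i
        by_cases hij : i = j
        · subst hij
          simp only [flip_apply, Function.update_self]
          revert hxy
          cases x i <;> cases y i <;> simp
        · simp [flip_apply, hij, hi]
      rw [this, hc] at hj
      simp at hj
  refine ⟨Equiv.ofBijective _ (Finite.injective_iff_bijective.1 hinj), fun x i hi => ?_,
    fun x => ?_⟩
  · simp [hi]
  · simp

/-- A permutation changing only the coordinates of `l` is realized by a pass through `l` followed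
by a pass in the opposite order: the rearrangeability of the Beneš network. -/
theorem mem_passes_mul_passes_reverse [Finite ι] (l : List ι) (g : Equiv.Perm (ι → Bool))
    (hg : ∀ x, ∀ i ∉ l, g x i = x i) : g ∈ passes l * passes l.reverse := by
  induction l generalizing g with
  | nil =>
    have : g = 1 := by ext x i; simp [hg]
    simp [this, passes]
  | cons j l ih =>
    obtain ⟨c, hc, hc'⟩ := exists_coloring_of_involutions (flip j) (g⁻¹ * flip j * g)
      (flip_mul_flip j) (by
        rw [show g⁻¹ * flip j * g * (g⁻¹ * flip j * g) = g⁻¹ * (flip j * flip j) * g by group,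
          flip_mul_flip]
        group)
      (flip_ne j) (fun x h => flip_ne j (g x) (by
        simpa using congrArg g h))
    obtain ⟨b, hb, hbc⟩ := exists_switch_of_coloring j c hc
    obtain ⟨a, ha, hac⟩ := exists_switch_of_coloring j (fun y => c (g⁻¹ y)) fun y => by
      simpa using hc' (g⁻¹ y)
    have hmid : a * g * b⁻¹ ∈ passes l * passes l.reverse := by
      refine ih _ fun x i hi => ?_
      by_cases hij : i = j
      · subst hij
        simpa [hac] using (hbc (b⁻¹ x)).symm
      · have hgi := hg (b⁻¹ x) i (by simp [hij, hi])
        simp only [Equiv.Perm.mul_apply]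
        rw [ha _ _ hij, hgi, inv_mem_switches hb _ _ hij]
    rw [List.reverse_cons, passes_append, passes_cons j l]
    have hj : passes [j] = switches j := by simp [passes]
    rw [hj, show switches j * passes l * (passes l.reverse * switches j) =
      switches j * (passes l * passes l.reverse) * switches j by simp only [mul_assoc]]
    rw [show g = a⁻¹ * (a * g * b⁻¹) * b by group]
    exact Set.mul_mem_mul (Set.mul_mem_mul (inv_mem_switches ha) hmid) hb

end Switches

section Reversal

variable {n : ℕ}

/-- Add the coordinate `rev i` to the coordinate `i`, unless they coincide. -/
def addRev (i : Fin n) : Equiv.Perm (Fin n → Bool) :=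
  Function.Involutive.toPerm
    (fun x => if i.rev = i then x else Function.update x i (xor (x i) (x i.rev))) fun x => by
      by_cases h : i.rev = i <;> simp [h]

theorem addRev_apply (i k : Fin n) (x : Fin n → Bool) :
    addRev i x k = if k = i ∧ i.rev ≠ i then xor (x i) (x i.rev) else x k := by
  by_cases h : i.rev = i
  · simp [addRev, h]
  · by_cases hk : k = i
    · subst hk; simp [addRev, h]
    · simp [addRev, h, hk]

theorem addRev_mem_switches (i : Fin n) : addRev i ∈ switches i := fun x k hk => by
  simp [addRev_apply, hk]

theorem prod_addRev_apply (l : List (Fin n)) (hl : l.Pairwise (· < ·)) (x : Fin n → Bool)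
    (i : Fin n) :
    (l.map addRev).prod x i =
      if i ∈ l ∧ i.rev ≠ i then
        if i < i.rev ∧ i.rev ∈ l then x i.rev else xor (x i) (x i.rev)
      else x i := by
  induction l generalizing i with
  | nil => simp
  | cons a l ih =>
    rw [List.pairwise_cons] at hl
    simp only [List.map_cons, List.prod_cons, Equiv.Perm.mul_apply, addRev_apply, ih hl.2,
      List.mem_cons, Fin.rev_rev]
    have ha : a ∉ l := fun h => lt_irrefl _ (hl.1 a h)
    by_cases hi : i = a
    · subst hi
      by_cases hr : i.rev = i
      · simp [hr]
      · by_cases hm : i.rev ∈ l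
        · have := hl.1 _ hm
          simp [ha, hr, hm, this, this.not_gt, Ne.symm hr]
          cases x i <;> cases x i.rev <;> rfl
        · simp [ha, hr, hm]
    · by_cases hm : i ∈ l
      · have hlt := hl.1 _ hm
        by_cases hr : i.rev = a
        · simp [hi, hm, hr, ha, hlt.not_gt]
        · simp [hi, hm, hr]
      · simp [hi, hm]

theorem prod_addRev_upper_apply (l : List (Fin n)) (hl : l.Pairwise (· < ·)) (x : Fin n → Bool)
    (i : Fin n) :
    (l.map fun k => if k.rev < k then addRev k else 1).prod x i =
      if i ∈ l ∧ i.rev < i then xor (x i) (x i.rev) else x i := by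
  induction l generalizing i with
  | nil => simp
  | cons a l ih =>
    rw [List.pairwise_cons] at hl
    have ha : a ∉ l := fun h => lt_irrefl _ (hl.1 a h)
    rw [List.map_cons, List.prod_cons, Equiv.Perm.mul_apply]
    by_cases hra : a.rev < a
    · simp only [hra, if_true, addRev_apply, ih hl.2, List.mem_cons, Fin.rev_rev]
      by_cases hi : i = a
      · subst hi
        simp [ha, hra, hra.ne, hra.not_gt]
      · simp [hi]
    · simp only [hra, if_false, Equiv.Perm.one_apply, ih hl.2, List.mem_cons]
      by_cases hi : i = a
      · subst hi
        simp [ha, hra]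
      · simp [hi]

theorem permuteCoords_rev_mem : permuteCoords (Fin.revPerm (n := n)) ∈
    passes (List.finRange n) * passes (List.finRange n) := by
  have hl := List.pairwise_lt_finRange n
  have h₁ := list_prod_mem_passes (List.finRange n)
    (fun k : Fin n => if k.rev < k then addRev k else 1) fun k => by
      split_ifs
      exacts [addRev_mem_switches k, one_mem_switches k]
  have h₂ := list_prod_mem_passes (List.finRange n) addRev addRev_mem_switches
  convert Set.mul_mem_mul h₁ h₂ using 1
  ext x i
  rw [Equiv.Perm.mul_apply, prod_addRev_upper_apply _ hl, prod_addRev_apply _ hl,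
    prod_addRev_apply _ hl]
  have hx : permuteCoords Fin.revPerm x i = x i.rev := rfl
  rw [hx]
  rcases lt_trichotomy i i.rev with h | h | h
  · simp [h, h.not_gt, h.ne']
  · simp [← h]
  · simp [h, h.not_gt, h.ne, h.ne']
    cases x i <;> cases x i.rev <;> rfl

theorem mem_passes_finRange_pow_four (g : Equiv.Perm (Fin n → Bool)) :
    g ∈ passes (List.finRange n) ^ 4 := by
  have h := mem_passes_mul_passes_reverse (List.finRange n) (g * (permuteCoords Fin.revPerm)⁻¹)
    fun x i hi => absurd (List.mem_finRange i) hi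
  rw [List.finRange_reverse, show (List.finRange n).map Fin.rev =
    (List.finRange n).map Fin.revPerm from rfl, passes_map_permuteCoords] at h
  obtain ⟨p, hp, -, ⟨q, hq, rfl⟩, h⟩ := h
  have hg : g = p * permuteCoords Fin.revPerm * q := by
    have h' := eq_mul_of_mul_inv_eq h.symm
    rw [h', MulAut.conj_apply]
    group
  rw [hg, show passes (List.finRange n) ^ 4 = passes (List.finRange n) *
    (passes (List.finRange n) * passes (List.finRange n)) * passes (List.finRange n) by
      simp only [pow_succ, pow_zero, one_mul, mul_assoc]]
  exact Set.mul_mem_mul (Set.mul_mem_mul hp permuteCoords_rev_mem) hq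

end Reversal

section Steps

theorem pow_switches_mul_permuteCoords {ι : Type*} (σ : Equiv.Perm ι) (j : ι) (k : ℕ) :
    (switches j * {permuteCoords σ}) ^ k =
      passes ((List.range k).map fun i => (σ ^ i) j) * {permuteCoords (σ ^ k)} := by
  induction k with
  | zero => simp [passes, Set.singleton_one]
  | succ k ih =>
    rw [pow_succ, ih, List.range_succ, List.map_append, passes_append, mul_assoc,
      ← mul_assoc {_} (switches j), permuteCoords_mul_switches, pow_succ, map_mul,
      ← Set.singleton_mul_singleton]
    simp only [passes, List.map_cons, List.map_nil, List.prod_cons, List.prod_nil, mul_one,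
      mul_assoc]

variable {n : ℕ} [NeZero n]

theorem val_addRight_one_pow_apply (k : ℕ) (i : Fin n) :
    (((Equiv.addRight (1 : Fin n)) ^ k) i).val = (i.val + k) % n := by
  induction k with
  | zero => simp [Nat.mod_eq_of_lt i.isLt]
  | succ k ih =>
    rw [pow_succ', Equiv.Perm.mul_apply, Equiv.coe_addRight, Fin.val_add, ih, Fin.val_one',
      ← Nat.add_mod, add_assoc]

theorem pow_card_eq_passes_finRange :
    (switches (0 : Fin n) * {permuteCoords (Equiv.addRight (1 : Fin n))}) ^ n =
      passes (List.finRange n) := by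
  have h : (Equiv.addRight (1 : Fin n)) ^ n = 1 := by
    ext i
    rw [val_addRight_one_pow_apply, Nat.add_mod_right, Nat.mod_eq_of_lt i.isLt]
    rfl
  rw [pow_switches_mul_permuteCoords, h, map_one, Set.singleton_one, mul_one,
    ← List.map_coe_finRange_eq_range, List.map_map]
  congr 1
  convert List.map_id _
  ext i
  rw [Function.comp_apply, val_addRight_one_pow_apply]
  simp [Nat.mod_eq_of_lt i.isLt]

theorem sr_eq_permuteCoords (w : Fin n → Bool) : sr w = permuteCoords (Equiv.addRight (1 : Fin n)) w := by
  funext j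
  rw [permuteCoords_apply, sr]
  congr 1
  rw [Equiv.Perm.eq_inv_iff_eq]
  ext
  have := NeZero.pos n
  simp only [Equiv.coe_addRight, Fin.val_add, Fin.val_one', Nat.mod_add_mod, Nat.add_mod_mod]
  rw [show j.val + (n - 1) + 1 = j.val + n by omega, Nat.add_mod_right, Nat.mod_eq_of_lt j.isLt]

theorem step_of_mem {g : Equiv.Perm (Fin n → Bool)}
    (hg : g ∈ switches (0 : Fin n) * {permuteCoords (Equiv.addRight (1 : Fin n))}) (w : Fin n → Bool) :
    g w = sr w ∨ g w = fun j => xor (sr w j) (ebit j) := by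
  obtain ⟨t, ht, _, rfl, rfl⟩ := hg
  rw [Equiv.Perm.mul_apply, ← sr_eq_permuteCoords]
  have hoff : ∀ j : Fin n, j ≠ 0 → t (sr w) j = sr w j := ht (sr w)
  by_cases h : t (sr w) 0 = sr w 0
  · left
    funext j
    by_cases hj : j = 0
    · rw [hj, h]
    · exact hoff j hj
  · right
    funext j
    by_cases hj : j = 0
    · subst hj
      revert h
      simp only [ebit]
      cases t (sr w) 0 <;> cases sr w 0 <;> simp
    · have : j.val ≠ 0 := fun h => hj (Fin.ext h)
      simp [hoff j hj, ebit, this]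

end Steps

theorem exists_seq_of_mem_pow {M : Type*} [Monoid M] (E : Set M) (k : ℕ) (g : M)
    (hg : g ∈ E ^ k) :
    ∃ y : ℕ → M, y 0 = 1 ∧ y k = g ∧ ∀ i < k, ∃ s ∈ E, y (i + 1) = s * y i := by
  induction k generalizing g with
  | zero => exact ⟨fun _ => 1, rfl, by simpa using hg.symm, by simp⟩
  | succ k ih =>
    rw [pow_succ'] at hg
    obtain ⟨s, hs, g, hg, rfl⟩ := hg
    obtain ⟨y, h0, hk, hy⟩ := ih g hg
    refine ⟨Function.update y (k + 1) (s * g), by simpa using h0, by simp, fun i hi => ?_⟩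
    rcases Nat.lt_succ_iff_lt_or_eq.1 hi with h | rfl
    · obtain ⟨u, hu, hy⟩ := hy i h
      refine ⟨u, hu, ?_⟩
      rw [Function.update_of_ne (by omega), Function.update_of_ne (by omega), hy]
    · exact ⟨s, hs, by simp [hk]⟩

end DeBruijn

/-- For every `n ≥ 1` and every permutation `π` of `Fin n → Bool`, the De Bruijn
layered graph with `4n+1` columns admits a system of node-disjoint paths realizing `π`. -/
theorem deBruijn_four_tandem_rearrangeable (n : ℕ) (hn : 1 ≤ n)
    (π : Equiv.Perm (Fin n → Bool)) :
    ∃ P : (Fin n → Bool) → Fin (4 * n + 1) → (Fin n → Bool),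
      (∀ w, P w 0 = w) ∧
      (∀ w, P w ⟨4 * n, by omega⟩ = π w) ∧
      (∀ w, ∀ i : ℕ, ∀ hi : i < 4 * n,
        P w ⟨i + 1, by omega⟩ = sr (P w ⟨i, by omega⟩) ∨
        P w ⟨i + 1, by omega⟩ = fun j => xor (sr (P w ⟨i, by omega⟩) j) (ebit j)) ∧
      (∀ i : Fin (4 * n + 1), Function.Injective (fun w => P w i)) := by
  have : NeZero n := ⟨by omega⟩
  have hπ := DeBruijn.mem_passes_finRange_pow_four π
  rw [← DeBruijn.pow_card_eq_passes_finRange, ← pow_mul, mul_comm n 4] at hπ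
  obtain ⟨y, h0, hk, hy⟩ := DeBruijn.exists_seq_of_mem_pow _ _ _ hπ
  refine ⟨fun w i => y i w, fun w => by simp [h0], fun w => by simp [hk], fun w i hi => ?_,
    fun i => (y i).injective⟩
  obtain ⟨s, hs, hsy⟩ := hy i hi
  simpa only [hsy, Equiv.Perm.mul_apply] using DeBruijn.step_of_mem hs (y i w)
end

section
/- Adding extra columns to the 4-tandem De Bruijn graph preserves rearrangeability: for every n ≥ 1, every L ≥ 4n, and every permutation π of the set Fin n → Bool, the De Bruijn layered graph with L+1 columns admits a system of node-disjoint paths realizing π. Precisely, there exists P : (Fin n → Bool) → Fin (L+1) → (Fin n → Bool) such that: (i) P w 0 = w for every w; (ii) P w L = π w for every w; (iii) for every w and every i < L, either P w (i+1) = sr (P w i) or P w (i+1) = (fun j => xor (sr (P w i) j) (e j)); and (iv) for every column index i, the map w ↦ P w i is injective. -/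
open scoped Pointwise

open Equiv

section TwoInvolutions

variable {α : Type*}

/-- Two fixed-point-free involutions of a type admit a common proper two-colouring. -/
theorem exists_coloring_of_involutions (σ τ : Perm α) (hσ : σ * σ = 1) (hτ : τ * τ = 1)
    (hσ' : ∀ x, σ x ≠ x) (hτ' : ∀ x, τ x ≠ x) :
    ∃ c : α → Bool, (∀ x, c (σ x) = !c x) ∧ ∀ x, c (τ x) = !c x := by
  classical
  have hσx : ∀ x, σ (σ x) = x := fun x => by simpa using congrArg (fun f : Perm α => f x) hσ
  have hτx : ∀ x, τ (τ x) = x := fun x => by simpa using congrArg (fun f : Perm α => f x) hτ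
  have hσi : σ⁻¹ = σ := inv_eq_of_mul_eq_one_left hσ
  have hτi : τ⁻¹ = τ := inv_eq_of_mul_eq_one_left hτ
  set g : Perm α := σ * τ with hg
  have hgi : g⁻¹ = τ * σ := by rw [hg, mul_inv_rev, hσi, hτi]
  have hconj : ∀ i : ℤ, σ * g ^ i = g ^ (-i) * σ := fun i => by
    have h : SemiconjBy σ g g⁻¹ := by
      rw [SemiconjBy, hgi, hg, ← mul_assoc, hσ, mul_assoc, hσ, one_mul, mul_one]
    have h' := h.zpow_right i
    rwa [SemiconjBy, inv_zpow'] at h'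
  have hconjx : ∀ (i : ℤ) (x : α), σ ((g ^ i) x) = (g ^ (-i)) (σ x) := fun i x =>
    congrArg (fun f : Perm α => f x) (hconj i)
  have hne : ∀ x, ¬ g.SameCycle x (σ x) := by
    rintro x ⟨m, hm⟩
    obtain ⟨i, rfl | rfl⟩ := Int.even_or_odd' m
    · apply hσ' ((g ^ i) x)
      rw [hconjx, ← hm, ← Perm.mul_apply, ← zpow_add]
      congr 2
      ring
    · apply hτ' ((g ^ i) x)
      apply σ.injective
      rw [hconjx, ← hm, ← Perm.mul_apply (g ^ (-i)), ← zpow_add, ← Perm.mul_apply σ τ, ← hg,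
        ← Perm.mul_apply, ← zpow_one_add]
      congr 2
      ring
  let Q := Quotient (Perm.SameCycle.setoid g)
  let _ : LinearOrder Q := linearOrderOfSTO (WellOrderingRel (α := Q))
  let q : α → Q := fun x => Quotient.mk _ x
  have hq : ∀ x, q x ≠ q (σ x) := fun x h => hne x (Quotient.exact h)
  have hqg : ∀ x, q (g x) = q x := fun x =>
    Quotient.sound (Perm.sameCycle_apply_left.2 (Perm.SameCycle.refl g x))
  have hqτ : ∀ x, q (σ (τ x)) = q x := hqg
  have hqτ' : ∀ x, q (τ x) = q (σ x) := fun x => by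
    simpa [hg, hτx] using (hqg (τ x)).symm
  refine ⟨fun x => decide (q x < q (σ x)), fun x => ?_, fun x => ?_⟩
  · simp only [hσx]
    rcases lt_or_gt_of_ne (hq x) with h | h <;> simp [h, h.le]
  · simp only [hqτ, hqτ']
    rcases lt_or_gt_of_ne (hq x) with h | h <;> simp [h, h.le]

end TwoInvolutions

section CoordPerms

variable {ι : Type*}

/-- The permutations of bit-vectors that change no coordinate other than `k`. -/
def coordPerms (k : ι) : Subgroup (Perm (ι → Bool)) where
  carrier := {g | ∀ w j, j ≠ k → g w j = w j}
  one_mem' := fun _ _ _ => rfl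
  mul_mem' := fun {a b} ha hb w j hj => (ha (b w) j hj).trans (hb w j hj)
  inv_mem' := fun {a} ha w j hj => by
    have h := ha (a⁻¹ w) j hj
    simpa using h.symm

/-- The permutations obtained by correcting, from right to left, the coordinates in a list. -/
def sweepPerms (ks : List ι) : Set (Perm (ι → Bool)) :=
  (ks.map fun k => (coordPerms k : Set (Perm (ι → Bool)))).prod

theorem sweepPerms_nil : sweepPerms ([] : List ι) = 1 := rfl

theorem sweepPerms_cons (k : ι) (ks : List ι) :
    sweepPerms (k :: ks) = (coordPerms k : Set (Perm (ι → Bool))) * sweepPerms ks :=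
  List.prod_cons

theorem sweepPerms_append (ks ls : List ι) :
    sweepPerms (ks ++ ls) = sweepPerms ks * sweepPerms ls := by
  simp [sweepPerms]

/-- Relabelling the coordinates of bit-vectors. -/
def relabel (e : Perm ι) : Perm (ι → Bool) := e.arrowCongr (Equiv.refl Bool)

theorem relabel_apply (e : Perm ι) (w : ι → Bool) (j : ι) : relabel e w j = w (e.symm j) := rfl

theorem conj_relabel_mem_sweepPerms (e : Perm ι) (ks : List ι) {x : Perm (ι → Bool)}
    (hx : x ∈ sweepPerms (ks.map e)) : (relabel e)⁻¹ * x * relabel e ∈ sweepPerms ks := by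
  induction ks generalizing x with
  | nil =>
    obtain rfl : x = 1 := hx
    rw [mul_one, inv_mul_cancel]
    exact Set.one_mem_one
  | cons k ks ih =>
    rw [List.map_cons, sweepPerms_cons] at hx
    obtain ⟨g, hg, y, hy, rfl⟩ := hx
    rw [sweepPerms_cons]
    refine ⟨(relabel e)⁻¹ * g * relabel e, fun w j hj => ?_, _, ih hy, by simp only; group⟩
    have h := hg (relabel e w) (e j) (e.injective.ne hj)
    rw [relabel_apply, e.symm_apply_apply] at h
    exact h

/-- The permutations obtained by correcting the coordinates `κ 0, …, κ (L - 1)` in turn. -/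
def columnPerms (κ : ℕ → ι) (L : ℕ) : Set (Perm (ι → Bool)) :=
  sweepPerms ((List.range L).reverse.map κ)

theorem columnPerms_succ (κ : ℕ → ι) (L : ℕ) :
    columnPerms κ (L + 1) = (coordPerms (κ L) : Set (Perm (ι → Bool))) * columnPerms κ L := by
  simp [columnPerms, List.range_succ, sweepPerms_cons]

theorem columnPerms_add (κ : ℕ → ι) (a b : ℕ) :
    columnPerms κ (a + b) = columnPerms (fun i => κ (a + i)) b * columnPerms κ a := by
  simp [columnPerms, List.range_add, sweepPerms_append, Function.comp_def]

theorem columnPerms_subset (κ : ℕ → ι) {a b : ℕ} (h : a ≤ b) :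
    columnPerms κ a ⊆ columnPerms κ b := by
  induction b, h using Nat.le_induction with
  | base => exact subset_rfl
  | succ b _ ih =>
    intro x hx
    rw [columnPerms_succ]
    exact ⟨1, one_mem _, x, ih hx, one_mul x⟩

theorem mem_columnPerms_of_chain {κ : ℕ → ι} {L : ℕ} (T : ℕ → Perm (ι → Bool)) (h0 : T 0 = 1)
    (h : ∀ i < L, ∀ w j, j ≠ κ i → T (i + 1) w j = T i w j) : T L ∈ columnPerms κ L := by
  induction L with
  | zero =>
    rw [h0]
    exact Set.one_mem_one
  | succ L ih =>
    rw [columnPerms_succ]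
    refine ⟨T (L + 1) * (T L)⁻¹, fun w j hj => ?_, T L,
      ih fun i hi => h i (hi.trans L.lt_succ_self), by simp⟩
    simpa using h L L.lt_succ_self ((T L)⁻¹ w) j hj

theorem exists_chain_of_mem_columnPerms {κ : ℕ → ι} {L : ℕ} {x : Perm (ι → Bool)}
    (hx : x ∈ columnPerms κ L) :
    ∃ T : ℕ → Perm (ι → Bool), T 0 = 1 ∧ T L = x ∧
      ∀ i < L, ∀ w j, j ≠ κ i → T (i + 1) w j = T i w j := by
  induction L generalizing x with
  | zero => exact ⟨fun _ => 1, rfl, Eq.symm hx, fun i hi => absurd hi i.not_lt_zero⟩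
  | succ L ih =>
    rw [columnPerms_succ] at hx
    obtain ⟨g, hg, y, hy, rfl⟩ := hx
    obtain ⟨T, h0, hL, hT⟩ := ih hy
    refine ⟨fun i => if i ≤ L then T i else g * y, by simpa using h0, by simp, ?_⟩
    intro i hi w j hj
    rcases Nat.lt_succ_iff_lt_or_eq.1 hi with h | rfl
    · simpa [Nat.succ_le_of_lt h, h.le] using hT i h w j hj
    · simpa [hL] using hg (y w) j hj

variable [DecidableEq ι]

/-- Negation of the coordinate `k` of a bit-vector. -/
def flipCoord (k : ι) : Perm (ι → Bool) where
  toFun w := Function.update w k (!w k)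
  invFun w := Function.update w k (!w k)
  left_inv w := by simp
  right_inv w := by simp

theorem flipCoord_apply (k : ι) (w : ι → Bool) :
    flipCoord k w = Function.update w k (!w k) := rfl

theorem flipCoord_mul_self (k : ι) : flipCoord k * flipCoord k = 1 := by
  ext1 w
  simp [flipCoord_apply]

theorem flipCoord_ne (k : ι) (w : ι → Bool) : flipCoord k w ≠ w := fun h => by
  have := congrFun h k
  simp [flipCoord_apply] at this

/-- Overwriting the coordinate `k` by a function that `flipCoord k` negates is a permutation. -/
theorem exists_coordPerm_eq_update (k : ι) (c : (ι → Bool) → Bool)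
    (hc : ∀ w, c (flipCoord k w) = !c w) :
    ∃ g ∈ coordPerms k, ∀ w, g w k = c w := by
  have hcu : ∀ w b, c (Function.update w k b) = xor (c w) (xor b (w k)) := fun w b => by
    by_cases hb : b = w k
    · subst hb
      simp
    · have hb' : b = !w k := Bool.eq_not_of_ne hb
      subst hb'
      rw [← flipCoord_apply, hc]
      simp
  let f : (ι → Bool) → ι → Bool := fun w => Function.update w k (c w)
  let f' : (ι → Bool) → ι → Bool := fun w =>
    Function.update w k (xor (w k) (c (Function.update w k false)))
  refine ⟨⟨f, f', fun w => ?_, fun w => ?_⟩, fun w j hj => ?_, fun w => ?_⟩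
  · simp only [f, f', Function.update_idem, Function.update_self, hcu]
    convert Function.update_eq_self k w using 2
    cases c w <;> cases w k <;> rfl
  · simp only [f, f', Function.update_idem, hcu]
    convert Function.update_eq_self k w using 2
    cases c w <;> cases w k <;> rfl
  · exact Function.update_of_ne hj _ _
  · exact Function.update_self _ _ _

/-- Corrections of one coordinate before and after a permutation make it preserve that
coordinate. -/
theorem exists_mul_mul_preserves_coord (k : ι) (π : Perm (ι → Bool)) :
    ∃ a ∈ coordPerms k, ∃ b ∈ coordPerms k, ∀ w, (a * π * b) w k = w k := by
  obtain ⟨c, hc, hc'⟩ := exists_coloring_of_involutions (flipCoord k)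
    (π⁻¹ * flipCoord k * π) (flipCoord_mul_self k)
    (by
      have h : π⁻¹ * flipCoord k * π * (π⁻¹ * flipCoord k * π)
          = π⁻¹ * (flipCoord k * flipCoord k) * π := by group
      rw [h, flipCoord_mul_self]
      group)
    (flipCoord_ne k)
    (fun x h => flipCoord_ne k (π x) (by
      rw [Perm.mul_apply, Perm.mul_apply, Perm.inv_eq_iff_eq] at h
      exact h))
  obtain ⟨b, hb, hbc⟩ := exists_coordPerm_eq_update k c hc
  obtain ⟨a, ha, hac⟩ := exists_coordPerm_eq_update k (fun w => c (π⁻¹ w)) (fun w => by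
    simpa using hc' (π⁻¹ w))
  refine ⟨a, ha, b⁻¹, inv_mem hb, fun w => ?_⟩
  obtain ⟨u, rfl⟩ := b.surjective w
  simp [hac, hbc]

/-- Beneš decomposition: a permutation that changes only the coordinates in a list is a product of
corrections of these coordinates in order and then in reverse order. -/
theorem mem_sweepPerms_mul_sweepPerms_reverse (ks : List ι) (π : Perm (ι → Bool))
    (hπ : ∀ w, ∀ j ∉ ks, π w j = w j) :
    π ∈ sweepPerms ks * sweepPerms ks.reverse := by
  induction ks generalizing π with
  | nil =>
    obtain rfl : π = 1 := Equiv.ext fun w => funext fun j => hπ w j List.not_mem_nil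
    exact ⟨1, rfl, 1, rfl, one_mul 1⟩
  | cons k ks ih =>
    obtain ⟨a, ha, b, hb, hab⟩ := exists_mul_mul_preserves_coord k π
    have h : ∀ w, ∀ j ∉ ks, (a * π * b) w j = w j := fun w j hj => by
      by_cases hjk : j = k
      · exact hjk ▸ hab w
      · rw [Perm.mul_apply, Perm.mul_apply, ha _ _ hjk, hπ _ _ (by simp [hjk, hj]), hb _ _ hjk]
    obtain ⟨x, hx, y, hy, hxy⟩ := ih _ h
    rw [List.reverse_cons, sweepPerms_append, sweepPerms_cons, sweepPerms_cons, sweepPerms_nil,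
      mul_one]
    refine ⟨a⁻¹ * x, Set.mul_mem_mul (inv_mem ha) hx, y * b⁻¹,
      Set.mul_mem_mul hy (inv_mem hb), ?_⟩
    calc a⁻¹ * x * (y * b⁻¹) = a⁻¹ * (x * y) * b⁻¹ := by group
      _ = a⁻¹ * (a * π * b) * b⁻¹ := by rw [← hxy]
      _ = π := by group

end CoordPerms

section DeBruijn

variable {n : ℕ}

/-- The coordinate, in the unshifted frame, that the edges leaving column `i` may change. -/
def activeCoord (hn : 0 < n) (i : ℕ) : Fin n := ⟨(i + 1) * (n - 1) % n, Nat.mod_lt _ hn⟩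

theorem activeCoord_add (hn : 0 < n) (i : ℕ) : activeCoord hn (n + i) = activeCoord hn i := by
  ext
  simp only [activeCoord]
  rw [show (n + i + 1) * (n - 1) = (i + 1) * (n - 1) + n * (n - 1) by ring,
    Nat.add_mul_mod_self_left]

theorem activeCoord_of_lt (hn : 0 < n) {i : ℕ} (hi : i < n) :
    (activeCoord hn i : ℕ) = n - 1 - i := by
  obtain ⟨m, rfl⟩ := Nat.exists_eq_add_of_lt hi
  simp only [activeCoord]
  rw [show (i + 1) * (i + m + 1 - 1) = m + (i + m + 1) * i by
      rw [Nat.add_sub_cancel]; ring,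
    Nat.add_mul_mod_self_left, Nat.mod_eq_of_lt (by omega)]
  omega

theorem columnPerms_activeCoord (hn : 0 < n) :
    columnPerms (activeCoord hn) n = sweepPerms (List.finRange n) := by
  rw [columnPerms]
  congr 1
  apply List.ext_getElem (by simp)
  intro i h _
  have hi : i < n := by simpa using h
  ext
  simp [activeCoord_of_lt hn (show n - 1 - i < n by omega)]
  omega

theorem columnPerms_activeCoord_add (hn : 0 < n) (m : ℕ) :
    columnPerms (activeCoord hn) (n + m) =
      columnPerms (activeCoord hn) m * columnPerms (activeCoord hn) n := by
  rw [columnPerms_add]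
  simp only [activeCoord_add]

/-- A family of injective maps starting at the identity, each changing one further coordinate,
ends in a single sweep. -/
theorem exists_mem_columnPerms_of_injective {κ : ℕ → Fin n} {L : ℕ}
    (T : ℕ → (Fin n → Bool) → Fin n → Bool) (hT : ∀ i, Function.Injective (T i))
    (h0 : ∀ w, T 0 w = w) (h : ∀ i < L, ∀ w j, j ≠ κ i → T (i + 1) w j = T i w j) :
    ∃ x ∈ columnPerms κ L, ∀ w, x w = T L w :=
  ⟨_, mem_columnPerms_of_chain
    (fun i => Equiv.ofBijective (T i) (Finite.injective_iff_bijective.1 (hT i)))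
    (Equiv.ext h0) h, fun _ => rfl⟩

/-- Bit reversal takes two sweeps: every pair of opposite coordinates is exchanged by three
controlled negations, two of them in the first sweep. -/
theorem relabel_rev_mem (hn : 0 < n) :
    relabel Fin.revPerm ∈
      columnPerms (activeCoord hn) n * columnPerms (activeCoord hn) n := by
  have hne : ∀ {i : ℕ} {j : Fin n}, i < n → j ≠ activeCoord hn i →
      (n ≤ j + (i + 1) ↔ n ≤ j + i) := fun {i j} hi hj => by
    have : (j : ℕ) ≠ n - 1 - i := fun h => hj (Fin.ext (h.trans (activeCoord_of_lt hn hi).symm))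
    omega
  obtain ⟨x, hx, hxw⟩ := exists_mem_columnPerms_of_injective (κ := activeCoord hn) (L := n)
    (fun i w j => if n ≤ j + i then
      if j.rev < j then xor (w j) (w j.rev) else w j.rev else w j)
    (fun i v w hvw => by
      funext j
      have h1 := congrFun hvw j
      have h2 := congrFun hvw j.rev
      have hj : (j.rev : ℕ) = n - (j + 1) := Fin.val_rev j
      simp only [Fin.rev_rev, Fin.lt_def] at h1 h2
      split_ifs at h1 h2 <;> first | grind | simpa [h2] using h1 | simpa [h1] using h2)
    (fun w => by
      funext j
      simp)
    (fun i hi w j hj => by simp only [hne hi hj])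
  obtain ⟨y, hy, hyw⟩ := exists_mem_columnPerms_of_injective (κ := activeCoord hn) (L := n)
    (fun i w j => if n ≤ j + i ∧ j.rev < j then xor (w j) (w j.rev) else w j)
    (fun i v w hvw => by
      funext j
      have h1 := congrFun hvw j
      have h2 := congrFun hvw j.rev
      have hj : (j.rev : ℕ) = n - (j + 1) := Fin.val_rev j
      simp only [Fin.rev_rev, Fin.lt_def] at h1 h2
      split_ifs at h1 h2 <;> first | grind | simpa [h2] using h1)
    (fun w => by
      funext j
      simp)
    (fun i hi w j hj => by simp only [hne hi hj])
  refine ⟨y, hy, x, hx, Equiv.ext fun w => funext fun j => ?_⟩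
  have hj : relabel Fin.revPerm w j = w j.rev := rfl
  simp only [Perm.mul_apply, hyw, hxw, hj, Fin.rev_rev]
  rcases lt_trichotomy j j.rev with h | h | h
  · simp [h.not_gt]
  · simp [← h]
  · simp [h, h.not_gt, Bool.xor_comm]

/-- Every permutation of bit-vectors is realised by four sweeps. -/
theorem mem_columnPerms_four_mul (hn : 0 < n) (π : Perm (Fin n → Bool)) :
    π ∈ columnPerms (activeCoord hn) (4 * n) := by
  obtain ⟨x, hx, y, hy, hxy⟩ := mem_sweepPerms_mul_sweepPerms_reverse (List.finRange n)
    (π * relabel Fin.revPerm) (fun _ j hj => absurd (List.mem_finRange j) hj)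
  rw [List.finRange_reverse] at hy
  have hy' := conj_relabel_mem_sweepPerms Fin.revPerm (List.finRange n) hy
  rw [← columnPerms_activeCoord hn] at hx hy'
  have hD : columnPerms (activeCoord hn) (4 * n) = columnPerms (activeCoord hn) n *
      (columnPerms (activeCoord hn) n * columnPerms (activeCoord hn) n) *
      columnPerms (activeCoord hn) n := by
    rw [show 4 * n = n + (n + (n + n)) by ring]
    simp only [columnPerms_activeCoord_add, mul_assoc]
  rw [hD]
  have h := Set.mul_mem_mul (Set.mul_mem_mul hx (relabel_rev_mem hn)) hy'
  have hπ : x * relabel Fin.revPerm * ((relabel Fin.revPerm)⁻¹ * y * relabel Fin.revPerm) = π := by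
    have hρ : relabel (Fin.revPerm (n := n)) * relabel Fin.revPerm = 1 := by
      ext w j
      simp [relabel_apply]
    calc _ = x * y * relabel Fin.revPerm := by group
      _ = π := by rw [show x * y = _ from hxy, mul_assoc, hρ, mul_one]
  rwa [hπ] at h

/-- The rotation of `Fin n` by `i * (n - 1)`, that is, by `-i`. -/
def rotIndex (i : ℕ) (j : Fin n) : Fin n := ⟨(j + i * (n - 1)) % n, Nat.mod_lt _ j.pos⟩

theorem rotIndex_injective (i : ℕ) : Function.Injective (rotIndex (n := n) i) := fun a b h => by
  have h' : a + i * (n - 1) ≡ b + i * (n - 1) [MOD n] := congrArg Fin.val h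
  exact Fin.ext ((Nat.ModEq.add_right_cancel' _ h').eq_of_lt_of_lt a.isLt b.isLt)

theorem rotIndex_succ (i : ℕ) (j : Fin n) :
    rotIndex i ⟨(j + (n - 1)) % n, Nat.mod_lt _ j.pos⟩ = rotIndex (i + 1) j := by
  ext
  simp only [rotIndex, Nat.mod_add_mod]
  congr 1
  ring

theorem rotIndex_eq_activeCoord (hn : 0 < n) (i : ℕ) :
    rotIndex (i + 1) ⟨0, hn⟩ = activeCoord hn i := by
  simp [rotIndex, activeCoord]

theorem comp_rotIndex_injective (i : ℕ) :
    Function.Injective fun (w : Fin n → Bool) j => w (rotIndex i j) :=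
  (Finite.injective_iff_surjective.1 (rotIndex_injective i)).injective_comp_right

end DeBruijn

/-- Adding extra columns preserves rearrangeability: for every `n ≥ 1`, every `L ≥ 4n`,
and every permutation `π` of `Fin n → Bool`, the De Bruijn layered graph with `L+1`
columns admits a system of node-disjoint paths realizing `π`. -/
theorem deBruijn_extra_columns_rearrangeable (n L : ℕ) (hn : 1 ≤ n) (hL : 4 * n ≤ L)
    (π : Equiv.Perm (Fin n → Bool)) :
    ∃ P : (Fin n → Bool) → Fin (L + 1) → (Fin n → Bool),
      (∀ w, P w 0 = w) ∧
      (∀ w, P w ⟨L, by omega⟩ = π w) ∧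
      (∀ w, ∀ i : ℕ, ∀ hi : i < L,
        P w ⟨i + 1, by omega⟩ = sr (P w ⟨i, by omega⟩) ∨
        P w ⟨i + 1, by omega⟩ = fun j => xor (sr (P w ⟨i, by omega⟩) j) (ebit j)) ∧
      (∀ i : Fin (L + 1), Function.Injective (fun w => P w i)) := by
  let r : Perm (Fin n → Bool) :=
    Equiv.ofBijective _ (Finite.injective_iff_bijective.1 (comp_rotIndex_injective L))
  obtain ⟨T, h0, hTL, hT⟩ := exists_chain_of_mem_columnPerms
    (columnPerms_subset _ hL (mem_columnPerms_four_mul hn (r⁻¹ * π)))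
  refine ⟨fun w i j => T i w (rotIndex i j), fun w => ?_, fun w => ?_, fun w i hi => ?_,
    fun i => ?_⟩
  · funext j
    simp [h0, rotIndex, Nat.mod_eq_of_lt j.isLt]
  · have h : r (T L w) = π w := by simp [hTL]
    exact h
  · have hsr : sr (fun j => T i w (rotIndex i j)) = fun j => T i w (rotIndex (i + 1) j) :=
      funext fun j => congrArg (T i w) (rotIndex_succ i j)
    have hstep : ∀ j : Fin n, j ≠ ⟨0, hn⟩ →
        T (i + 1) w (rotIndex (i + 1) j) = T i w (rotIndex (i + 1) j) := fun j hj =>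
      hT i hi w _ (rotIndex_eq_activeCoord hn i ▸ (rotIndex_injective (i + 1)).ne hj)
    simp only [hsr]
    by_cases hz : T (i + 1) w (rotIndex (i + 1) ⟨0, hn⟩) = T i w (rotIndex (i + 1) ⟨0, hn⟩)
    · left
      funext j
      by_cases hj : j = ⟨0, hn⟩
      · rw [hj, hz]
      · exact hstep j hj
    · right
      funext j
      by_cases hj : j = ⟨0, hn⟩
      · rw [hj, Bool.eq_not_of_ne hz]
        simp [ebit]
      · have hj' : (j : ℕ) ≠ 0 := fun h => hj (Fin.ext h)
        simp [hstep j hj, ebit, hj']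
  · exact (comp_rotIndex_injective (i : ℕ)).comp (T i).injective
end

section
/- The delayed-carry counter correctly counts with lag: let z be the all-false state (both components identically false). Then for every t : ℕ and every i : Fin m, the value-bit component of the t-fold iterate of U on z satisfies (U^[t] z).2 i = Nat.testBit (t − i) i, where − denotes truncated subtraction on ℕ, i is viewed as a natural number, and Nat.testBit a k is the k-th bit of the binary representation of a. -/
/-- The delayed-carry counter update on pairs `(c, b)` of carry bits and value bits:
`c' 0 = b 0`, `b' 0 = not (b 0)`, and for `1 ≤ i < m`:
`c' i = b i && c (i-1)`, `b' i = xor (b i) (c (i-1))`. -/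
def Udc {m : ℕ} (s : (Fin m → Bool) × (Fin m → Bool)) :
    (Fin m → Bool) × (Fin m → Bool) :=
  (fun i => if i.val = 0 then s.2 i
            else s.2 i && s.1 ⟨i.val - 1, by have := i.isLt; omega⟩,
   fun i => if i.val = 0 then ! s.2 i
            else xor (s.2 i) (s.1 ⟨i.val - 1, by have := i.isLt; omega⟩))

theorem Nat.testBit_succ_eq_xor (n i : ℕ) :
    (n + 1).testBit i = Bool.xor (n.testBit i) (decide (2 ^ i ∣ n + 1)) := by
  simp only [Nat.testBit_eq_decide_div_mod_eq, Nat.succ_div]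
  by_cases h : 2 ^ i ∣ n + 1
  · rcases Nat.mod_two_eq_zero_or_one (n / 2 ^ i) with h' | h' <;> simp [h, h', Nat.add_mod]
  · simp [h]

theorem Nat.two_pow_succ_dvd_succ_iff (n i : ℕ) :
    2 ^ (i + 1) ∣ n + 1 ↔ n.testBit i = true ∧ 2 ^ i ∣ n + 1 := by
  by_cases h : 2 ^ i ∣ n + 1
  · have hq : (n + 1) / 2 ^ i = n / 2 ^ i + 1 := by simp [Nat.succ_div, h]
    have hdvd : 2 ^ (i + 1) ∣ n + 1 ↔ 2 ∣ (n + 1) / 2 ^ i := by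
      rw [pow_succ, Nat.dvd_div_iff_mul_dvd h]
    rw [hdvd, hq, Nat.testBit_eq_decide_div_mod_eq, decide_eq_true_iff]
    simp only [h, and_true]
    omega
  · simp only [h, and_false, iff_false]
    exact fun h' => h ((pow_dvd_pow 2 i.le_succ).trans h')

/-- After `t` steps the `i`-th carry bit records whether the lagged counter `t - i` has just
overflowed its lowest `i + 1` bits. -/
theorem Udc_iterate_eq {m : ℕ} (t : ℕ) :
    Udc^[t] ((fun _ => false, fun _ => false) : (Fin m → Bool) × (Fin m → Bool)) =
      (fun i => decide (i.val < t ∧ 2 ^ (i.val + 1) ∣ t - i.val),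
        fun i => Nat.testBit (t - i.val) i.val) := by
  induction t with
  | zero => simp
  | succ t ih =>
    rw [Function.iterate_succ_apply', ih]
    ext ⟨i, hi⟩
    · rcases i with _ | i
      · have := Nat.two_pow_succ_dvd_succ_iff t 0
        simp_all [Udc]
      · by_cases hit : i < t
        · obtain ⟨n, rfl⟩ := Nat.exists_eq_add_of_le (Nat.succ_le_of_lt hit)
          have h₁ : i.succ + n - (i + 1) = n := by omega
          have h₂ : i.succ + n - i = n + 1 := by omega
          have h₃ : i.succ + n + 1 - (i + 1) = n + 1 := by omega
          simp [Udc, h₁, h₂, h₃, hit, Nat.two_pow_succ_dvd_succ_iff n (i + 1)]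
        · simp [Udc, hit]
    · rcases i with _ | i
      · have := Nat.testBit_succ_eq_xor t 0
        simp_all [Udc]
      · by_cases hit : i < t
        · obtain ⟨n, rfl⟩ := Nat.exists_eq_add_of_le (Nat.succ_le_of_lt hit)
          have h₁ : i.succ + n - (i + 1) = n := by omega
          have h₂ : i.succ + n - i = n + 1 := by omega
          have h₃ : i.succ + n + 1 - (i + 1) = n + 1 := by omega
          simp [Udc, h₁, h₂, h₃, hit, Nat.testBit_succ_eq_xor n (i + 1)]
        · have h₁ : t - (i + 1) = 0 := by omega
          have h₂ : t - i = 0 := by omega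
          simp [Udc, hit, h₁, h₂]

/-- The delayed-carry counter counts with lag: starting from the all-false state,
after `t` steps the `i`-th value bit is the `i`-th bit of `t - i`. -/
theorem delayedCarry_counts (m : ℕ) (hm : 1 ≤ m) (t : ℕ) (i : Fin m) :
    (Udc^[t] ((fun _ => false, fun _ => false) :
        (Fin m → Bool) × (Fin m → Bool))).2 i
      = Nat.testBit (t - i.val) i.val := by
  rw [Udc_iterate_eq]
end

section
/- From every initial state of the delayed-carry counter, repeated application of the update eventually makes the most significant value bit true: for every state s : (Fin m → Bool) × (Fin m → Bool), there exists t : ℕ such that (U^[t] s).2 ⟨m−1⟩ = true. -/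
/-- A set carry bit after an update comes from a set value bit before it. -/
lemma snd_of_fst_Udc {m : ℕ} (s : (Fin m → Bool) × (Fin m → Bool)) (i : Fin m)
    (h : (Udc s).1 i = true) : s.2 i = true := by
  simp only [Udc] at h
  split_ifs at h <;> simp_all

/-- Every carry bit of the delayed-carry counter is set infinitely often. -/
lemma exists_ge_fst_iterate_Udc {m : ℕ} (s : (Fin m → Bool) × (Fin m → Bool)) (i : ℕ)
    (hi : i < m) (T : ℕ) : ∃ t ≥ T, (Udc^[t] s).1 ⟨i, hi⟩ = true := by
  induction i generalizing T with
  | zero =>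
    have hc (t : ℕ) : (Udc^[t + 1] s).1 ⟨0, hi⟩ = (Udc^[t] s).2 ⟨0, hi⟩ := by
      simp [Function.iterate_succ_apply', Udc]
    have hb (t : ℕ) : (Udc^[t + 1] s).2 ⟨0, hi⟩ = !(Udc^[t] s).2 ⟨0, hi⟩ := by
      simp [Function.iterate_succ_apply', Udc]
    cases h : (Udc^[T] s).2 ⟨0, hi⟩ with
    | true => exact ⟨T + 1, by omega, by rw [hc, h]⟩
    | false => exact ⟨T + 2, by omega, by rw [hc, hb, h]; rfl⟩
  | succ i ih =>
    have hi' : i < m := by omega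
    have hc (t : ℕ) : (Udc^[t + 1] s).1 ⟨i + 1, hi⟩ =
        ((Udc^[t] s).2 ⟨i + 1, hi⟩ && (Udc^[t] s).1 ⟨i, hi'⟩) := by
      simp [Function.iterate_succ_apply', Udc]
    have hb (t : ℕ) : (Udc^[t + 1] s).2 ⟨i + 1, hi⟩ =
        xor ((Udc^[t] s).2 ⟨i + 1, hi⟩) ((Udc^[t] s).1 ⟨i, hi'⟩) := by
      simp [Function.iterate_succ_apply', Udc]
    by_contra! hne
    -- Without a carry out, the value bit is set by the first carry in and never cleared.
    have hand (t : ℕ) (ht : T ≤ t) :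
        ((Udc^[t] s).2 ⟨i + 1, hi⟩ && (Udc^[t] s).1 ⟨i, hi'⟩) = false := by
      rw [← hc]
      simpa using hne (t + 1) (by omega)
    obtain ⟨t₀, ht₀, hc₀⟩ := ih hi' T
    have hset (t : ℕ) (ht : t₀ + 1 ≤ t) : (Udc^[t] s).2 ⟨i + 1, hi⟩ = true := by
      induction t, ht using Nat.le_induction with
      | base =>
        have := hand t₀ ht₀
        simp_all
      | succ t ht iht =>
        have := hand t (by omega)
        simp_all
    obtain ⟨t₁, ht₁, hc₁⟩ := ih hi' (t₀ + 1)
    simpa [hset t₁ ht₁, hc₁] using hand t₁ (by omega)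

/-- From every initial state of the delayed-carry counter, repeated application of the
update eventually makes the most significant value bit true. -/
theorem delayedCarry_msb_eventually_true (m : ℕ) (hm : 1 ≤ m)
    (s : (Fin m → Bool) × (Fin m → Bool)) :
    ∃ t : ℕ, (Udc^[t] s).2 ⟨m - 1, by omega⟩ = true := by
  obtain ⟨t, ht, h⟩ := exists_ge_fst_iterate_Udc s (m - 1) (by omega) 1
  obtain ⟨t, rfl⟩ := Nat.exists_eq_add_of_le' ht
  rw [Function.iterate_succ_apply'] at h
  exact ⟨t, snd_of_fst_Udc _ _ h⟩
end
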